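/- Let T ∈ ITM(r) be a finite type map that satisfies conditions A1, A2 and Matching. Then the forward orbit of any point z ∈ X enters at most one interval component of X that contains a discontinuity of T. -/

import Mathlib

open Set Filter
open scoped Classical

/-- An interval translation map on `r ≥ 2` intervals: discontinuity points
`0 = β₀ < β₁ < ⋯ < β_{r−1} < β_r = 1` and translation parameters
`γ_i ∈ [−β_{i−1}, 1−β_i]`, acting by `T(x) = x + γ_i` for `x ∈ [β_{i−1}, β_i)`. -/
structure ITM (r : ℕ) : Type where
  beta : Fin (r + 1) → ℝ
  gamma : Fin r → ℝ
  two_le_r : 2 ≤ r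
  beta_zero : beta 0 = 0
  beta_last : beta (Fin.last r) = 1
  beta_mono : StrictMono beta
  gamma_mem : ∀ i : Fin r, gamma i ∈ Set.Icc (-(beta i.castSucc)) (1 - beta i.succ)

namespace ITM

variable {r : ℕ}

/-- The unit interval `I = [0,1)`. -/
def unitIco : Set ℝ := Set.Ico 0 1

/-- Index of the partition interval `I_i = [β_{i−1}, β_i)` containing `x`. -/
noncomputable def idx (T : ITM r) (x : ℝ) : Fin r :=
  if h : ∃ i : Fin r, x ∈ Set.Ico (T.beta i.castSucc) (T.beta i.succ) then h.choose
  else ⟨0, by have := T.two_le_r; omega⟩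

/-- The interval translation map itself (right-continuous version), extended by the
identity off `[0,1)`. -/
noncomputable def f (T : ITM r) (x : ℝ) : ℝ :=
  if x ∈ unitIco then x + T.gamma (T.idx x) else x

/-- Index of the partition interval `(β_{i−1}, β_i]` containing `x` (left-limit version). -/
noncomputable def idxm (T : ITM r) (x : ℝ) : Fin r :=
  if h : ∃ i : Fin r, x ∈ Set.Ioc (T.beta i.castSucc) (T.beta i.succ) then h.choose
  else ⟨0, by have := T.two_le_r; omega⟩

/-- The left-limit version of `T`: `T(x⁻) = lim_{t↑x} T(t)`. -/
noncomputable def fm (T : ITM r) (x : ℝ) : ℝ :=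
  if x ∈ Set.Ioc (0 : ℝ) 1 then x + T.gamma (T.idxm x) else x

/-- Dynamics on signed points: `(x, true)` represents `x⁺` and `(x, false)` represents `x⁻`. -/
noncomputable def sf (T : ITM r) (p : ℝ × Bool) : ℝ × Bool :=
  if p.2 then (T.f p.1, true) else (T.fm p.1, false)

/-- `X_n = T^n(I)`. -/
noncomputable def Xn (T : ITM r) (n : ℕ) : Set ℝ := (T.f)^[n] '' unitIco

/-- The attractor `X = ⋂_{n≥0} X_n`. -/
noncomputable def X (T : ITM r) : Set ℝ := ⋂ n : ℕ, T.Xn n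

/-- The closure `X̄` of the attractor in `[0,1]` (equivalently, in `ℝ`). -/
noncomputable def Xbar (T : ITM r) : Set ℝ := closure T.X

/-- `T` is of finite type if `X_{n+1} = X_n` for some `n`. -/
def FiniteType (T : ITM r) : Prop := ∃ n : ℕ, T.Xn (n + 1) = T.Xn n

/-- The set of (unsigned) discontinuities `{β₁, …, β_{r−1}}` of `T`. -/
def critSet (T : ITM r) : Set ℝ :=
  {b : ℝ | ∃ i : Fin (r + 1), i ≠ 0 ∧ i ≠ Fin.last r ∧ b = T.beta i}

/-- The signed critical set `𝒞 = {β₁⁻, β₁⁺, …, β_{r−1}⁻, β_{r−1}⁺}`. -/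
def signedCrit (T : ITM r) : Set (ℝ × Bool) := {p : ℝ × Bool | p.1 ∈ T.critSet}

/-- `x` lands on a discontinuity of `T`: some forward iterate (`k ≥ 0`) is a discontinuity. -/
def landsOnCrit (T : ITM r) (x : ℝ) : Prop := ∃ k : ℕ, (T.f)^[k] x ∈ T.critSet

/-- The first return time of `x` to the set `J` (by convention `0` if `x` never returns). -/
noncomputable def returnTime (T : ITM r) (J : Set ℝ) (x : ℝ) : ℕ :=
  sInf {k : ℕ | 0 < k ∧ (T.f)^[k] x ∈ J}

/-- The first return map `R_J`. -/
noncomputable def returnMap (T : ITM r) (J : Set ℝ) (x : ℝ) : ℝ :=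
  (T.f)^[T.returnTime J x] x

/-- `J` is an interval component of `X`: a connected component of `X` which is a
(nondegenerate, half-open) interval `[x,y)`. -/
def IsIntervalComponent (T : ITM r) (J : Set ℝ) : Prop :=
  (∃ z ∈ T.X, J = connectedComponentIn T.X z) ∧ ∃ x y : ℝ, x < y ∧ J = Set.Ico x y

/-- A dynamically trivial interval component: no point of its interior lands on a
discontinuity and the first return map is the identity. -/
def DynTrivial (T : ITM r) (J : Set ℝ) : Prop :=
  T.IsIntervalComponent J ∧ (∀ a ∈ interior J, ¬ T.landsOnCrit a) ∧
    ∀ z ∈ J, T.returnMap J z = z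

/-- Signed membership in `[x,y)`: `+`-points of `[x,y)` and `−`-points of `(x,y]`. -/
def smem (x y : ℝ) (p : ℝ × Bool) : Prop :=
  if p.2 then p.1 ∈ Set.Ico x y else p.1 ∈ Set.Ioc x y

/-- First return time of a signed point to the interval `[x,y)`. -/
noncomputable def sReturnTime (T : ITM r) (x y : ℝ) (p : ℝ × Bool) : ℕ :=
  sInf {k : ℕ | 0 < k ∧ smem x y ((T.sf)^[k] p)}

/-- Condition A1: for every interval component `J` of `X` and every `a ∈ J`, the orbit of
`a` up to (and not including) its return time to `J` contains at most one critical point. -/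
def A1 (T : ITM r) : Prop :=
  ∀ J : Set ℝ, T.IsIntervalComponent J → ∀ a ∈ J,
    Set.Subsingleton {c : ℝ | c ∈ T.critSet ∧ ∃ k < T.returnTime J a, (T.f)^[k] a = c}

/-- Condition A2: for every dynamically non-trivial interval component `[x,y)`, neither
(signed) boundary point `x⁺`, `y⁻` lands on a discontinuity up to (and not including)
its return time. -/
def A2 (T : ITM r) : Prop :=
  ∀ x y : ℝ, T.IsIntervalComponent (Set.Ico x y) → ¬ T.DynTrivial (Set.Ico x y) →
    (∀ k < T.sReturnTime x y (x, true), (T.sf)^[k] (x, true) ∉ T.signedCrit) ∧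
    (∀ k < T.sReturnTime x y (y, false), (T.sf)^[k] (y, false) ∉ T.signedCrit)

/-- `c'` is a ghost preimage of `c`: a signed discontinuity of opposite sign whose
(signed) orbit lands on the point of `c` with the sign of `c'`. -/
def GhostPre (T : ITM r) (c' c : ℝ × Bool) : Prop :=
  c ∈ T.signedCrit ∧ c' ∈ T.signedCrit ∧ c'.2 = !c.2 ∧
    ∃ k : ℕ, (T.sf)^[k] c' = (c.1, c'.2)

/-- A descending chain of length `n` in a ghost tree: `c (i+1)` is a ghost preimage of `c i`. -/
def GhostChain (T : ITM r) (n : ℕ) (c : ℕ → ℝ × Bool) : Prop :=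
  ∀ i < n, T.GhostPre (c (i + 1)) (c i)

/-- `b` occurs as a vertex of positive level in its own ghost tree `GT(b)`. -/
def SelfGhost (T : ITM r) (b : ℝ × Bool) : Prop :=
  ∃ n : ℕ, 0 < n ∧ ∃ c : ℕ → ℝ × Bool, c 0 = b ∧ c n = b ∧ T.GhostChain n c

/-- Condition A3: no discontinuity `β ∉ X` occurs in its own ghost tree at positive level. -/
def A3 (T : ITM r) : Prop := ∀ b ∈ T.signedCrit, b.1 ∉ T.X → ¬ T.SelfGhost b

/-- The Absence of Critical Connections condition. -/
def ACC (T : ITM r) : Prop := T.A1 ∧ T.A2 ∧ T.A3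

/-- The Matching condition: for every dynamically non-trivial interval component `J` of
`X`, exactly one point of the interior of `J` lands on a critical point before returning. -/
def Matching (T : ITM r) : Prop :=
  ∀ J : Set ℝ, T.IsIntervalComponent J → ¬ T.DynTrivial J →
    ∃! a : ℝ, a ∈ interior J ∧ ∃ k < T.returnTime J a, (T.f)^[k] a ∈ T.critSet

/-- Distance between two maps in the parameter space `ITM(r)`. -/
noncomputable def pdist (T S : ITM r) : ℝ := dist T.gamma S.gamma ⊔ dist T.beta S.beta

/-- The number of discontinuities of `T` contained in `I ∖ X̄`. -/
noncomputable def ncritOutside (T : ITM r) : ℕ := (T.critSet \ T.Xbar).ncard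

/-- `T` is stable: on some neighbourhood `𝒰` of `T` in `ITM(r)`, the assignment
`T̃ ↦ X̄(T̃)` is continuous in the Hausdorff topology, all `X̄(T̃)` are homeomorphic to
`X̄(T)`, and the number of discontinuities in `I ∖ X̄(T̃)` is constant. -/
def Stable (T : ITM r) : Prop :=
  ∃ δ : ℝ, 0 < δ ∧
    (∀ S : ITM r, pdist S T < δ → Nonempty (S.Xbar ≃ₜ T.Xbar)) ∧
    (∀ S : ITM r, pdist S T < δ → ∀ ε : ℝ, 0 < ε → ∃ η : ℝ, 0 < η ∧
      ∀ S' : ITM r, pdist S' T < δ → pdist S' S < η →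
        Metric.hausdorffDist S'.Xbar S.Xbar < ε) ∧
    (∀ S : ITM r, pdist S T < δ → S.ncritOutside = T.ncritOutside)

/-- The non-wandering set `Ω(T)` (neighbourhoods taken inside `I = [0,1)`). -/
def nonwandering (T : ITM r) : Set ℝ :=
  {x : ℝ | x ∈ unitIco ∧ ∀ U : Set ℝ, IsOpen U → x ∈ U →
    ∃ n : ℕ, 0 < n ∧ ((T.f)^[n] '' (U ∩ unitIco) ∩ (U ∩ unitIco)).Nonempty}

/-- `S` and `S'` are topologically conjugate on the sets `A`, `B`: there is a
homeomorphism `h : A → B` with `h ∘ S = S' ∘ h` on `A`. -/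
def TopConjOn (S S' : ITM r) (A B : Set ℝ) : Prop :=
  ∃ h g : ℝ → ℝ, Set.BijOn h A B ∧ ContinuousOn h A ∧ Set.InvOn g h A B ∧
    ContinuousOn g B ∧ ∀ x ∈ A, h (S.f x) = S'.f (h x)

/-- No point of the interior of `K` lands on a discontinuity before its return time to `J`. -/
def NoCritBeforeReturnOn (T : ITM r) (J K : Set ℝ) : Prop :=
  ∀ z ∈ interior K, ∀ k < T.returnTime J z, (T.f)^[k] z ∉ T.critSet

/-- `K` is a continuity interval of the first return map `R_J`: a maximal half-open
subinterval of `J` no interior point of which lands on a discontinuity before returning. -/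
def IsContinuityInterval (T : ITM r) (J K : Set ℝ) : Prop :=
  (∃ u v : ℝ, u < v ∧ K = Set.Ico u v) ∧ K ⊆ J ∧ T.NoCritBeforeReturnOn J K ∧
    ∀ K' : Set ℝ, (∃ u v : ℝ, u < v ∧ K' = Set.Ico u v) → K ⊆ K' → K' ⊆ J →
      T.NoCritBeforeReturnOn J K' → K' = K

/-- The itinerary symbol of a signed point. -/
noncomputable def sidx (T : ITM r) (p : ℝ × Bool) : Fin r :=
  if p.2 then T.idx p.1 else T.idxm p.1

/-- The forward orbit of `x` accumulates on `c` from the left. -/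
def accumFromLeft (T : ITM r) (x c : ℝ) : Prop :=
  ∃ n : ℕ → ℕ, StrictMono n ∧ StrictMono (fun k => (T.f)^[n k] x) ∧
    Filter.Tendsto (fun k => (T.f)^[n k] x) Filter.atTop (nhds c)

/-- The forward orbit of `x` accumulates on `c` from the right. -/
def accumFromRight (T : ITM r) (x c : ℝ) : Prop :=
  ∃ n : ℕ → ℕ, StrictMono n ∧ StrictAnti (fun k => (T.f)^[n k] x) ∧
    Filter.Tendsto (fun k => (T.f)^[n k] x) Filter.atTop (nhds c)

end ITM

open MeasureTheory

namespace ITM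

variable {r : ℕ}

section Basic

variable (T : ITM r)

lemma exists_mem_Ico {x : ℝ} (hx : x ∈ unitIco) :
    ∃ i : Fin r, x ∈ Ico (T.beta i.castSucc) (T.beta i.succ) := by
  by_contra! hne
  have key : ∀ i : Fin (r + 1), T.beta i ≤ x := by
    intro i
    induction i using Fin.induction with
    | zero => rw [T.beta_zero]; exact hx.1
    | succ i ih =>
      by_contra! hlt
      exact hne i ⟨ih, hlt⟩
  have := key (Fin.last r)
  rw [T.beta_last] at this
  exact absurd hx.2 (not_lt.mpr this)

lemma exists_mem_Ioc {x : ℝ} (hx : x ∈ Ioc (0 : ℝ) 1) :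
    ∃ i : Fin r, x ∈ Ioc (T.beta i.castSucc) (T.beta i.succ) := by
  by_contra! hne
  have key : ∀ i : Fin (r + 1), T.beta i < x := by
    intro i
    induction i using Fin.induction with
    | zero => rw [T.beta_zero]; exact hx.1
    | succ i ih =>
      by_contra! hlt
      exact hne i ⟨ih, hlt⟩
  have := key (Fin.last r)
  rw [T.beta_last] at this
  exact absurd hx.2 (not_le.mpr this)

lemma beta_nonneg (i : Fin (r + 1)) : 0 ≤ T.beta i := by
  rw [← T.beta_zero]
  exact T.beta_mono.monotone (Fin.zero_le i)

lemma beta_le_one (i : Fin (r + 1)) : T.beta i ≤ 1 := by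
  rw [← T.beta_last]
  exact T.beta_mono.monotone (Fin.le_last i)

lemma Ico_index_unique {x : ℝ} {i j : Fin r}
    (hi : x ∈ Ico (T.beta i.castSucc) (T.beta i.succ))
    (hj : x ∈ Ico (T.beta j.castSucc) (T.beta j.succ)) : i = j := by
  have h₁ := T.beta_mono.lt_iff_lt.mp (hi.1.trans_lt hj.2)
  have h₂ := T.beta_mono.lt_iff_lt.mp (hj.1.trans_lt hi.2)
  rw [Fin.lt_def] at h₁ h₂
  simp only [Fin.val_castSucc, Fin.val_succ] at h₁ h₂
  exact Fin.ext (by omega)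

lemma f_eq {x : ℝ} {i : Fin r} (hi : x ∈ Ico (T.beta i.castSucc) (T.beta i.succ)) :
    T.f x = x + T.gamma i := by
  have hx : x ∈ unitIco :=
    ⟨(T.beta_nonneg _).trans hi.1, hi.2.trans_le (T.beta_le_one _)⟩
  have hex : ∃ i : Fin r, x ∈ Ico (T.beta i.castSucc) (T.beta i.succ) := ⟨i, hi⟩
  have hidx : T.idx x = i := by
    rw [idx, dif_pos hex]
    exact T.Ico_index_unique hex.choose_spec hi
  rw [f, if_pos hx, hidx]

lemma exists_fm_eq {x : ℝ} (hx : x ∈ Ioc (0 : ℝ) 1) :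
    ∃ i : Fin r, x ∈ Ioc (T.beta i.castSucc) (T.beta i.succ) ∧ T.fm x = x + T.gamma i := by
  have hex := T.exists_mem_Ioc hx
  refine ⟨hex.choose, hex.choose_spec, ?_⟩
  rw [fm, if_pos hx, idxm, dif_pos hex]

lemma mapsTo_f_unitIco : MapsTo T.f unitIco unitIco := by
  intro x hx
  obtain ⟨i, hi⟩ := T.exists_mem_Ico hx
  have hγ := T.gamma_mem i
  rw [T.f_eq hi]
  exact ⟨by linarith [hγ.1, hi.1], by linarith [hγ.2, hi.2]⟩

/-- `T` is a translation on a compact interval with no discontinuity beyond its left end. -/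
lemma f_eq_of_no_crit {p q v : ℝ} (hp : 0 ≤ p) (hq : q < 1)
    (hc : ∀ w ∈ Ioc p q, w ∉ T.critSet) (hv : v ∈ Icc p q) : T.f v = T.f p + (v - p) := by
  obtain ⟨i, hi⟩ := T.exists_mem_Ico (x := p) ⟨hp, (hv.1.trans hv.2).trans_lt hq⟩
  have hlt : v < T.beta i.succ := by
    by_contra! hle
    refine hc (T.beta i.succ) ⟨hi.2, hle.trans hv.2⟩ ⟨i.succ, Fin.succ_ne_zero i, ?_, rfl⟩
    intro hlast
    rw [hlast, T.beta_last] at hle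
    linarith [hv.2]
  rw [T.f_eq hi, T.f_eq (x := v) ⟨hi.1.trans hv.1, hlt⟩]
  ring

lemma f_eq_fm {e : ℝ} (h₀ : 0 < e) (h₁ : e < 1) (hc : e ∉ T.critSet) : T.f e = T.fm e := by
  obtain ⟨i, hi, hfm⟩ := T.exists_fm_eq (x := e) ⟨h₀, h₁.le⟩
  rw [hfm]
  refine T.f_eq ⟨hi.1.le, lt_of_le_of_ne hi.2 ?_⟩
  intro heq
  refine hc ⟨i.succ, Fin.succ_ne_zero i, ?_, heq⟩
  intro hlast
  rw [heq, hlast, T.beta_last] at h₁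
  exact lt_irrefl _ h₁

/-- The left-limit map extends a translation to the right end of a half-open interval. -/
lemma fm_eq_of_translation {q e s : ℝ} (hq : 0 ≤ q) (hqe : q < e) (he : e ≤ 1)
    (hs : ∀ p ∈ Ico q e, T.f p = p + s) : T.fm e = e + s := by
  obtain ⟨i, hi, hfm⟩ := T.exists_fm_eq (x := e) ⟨hq.trans_lt hqe, he⟩
  obtain ⟨p, hp, hpe⟩ := exists_between (max_lt hqe hi.1)
  have hp' := max_lt_iff.mp hp
  have h₁ := hs p ⟨hp'.1.le, hpe⟩
  rw [T.f_eq (x := p) ⟨hp'.2.le, hpe.trans_le hi.2⟩] at h₁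
  rw [hfm]
  linarith

/-- Every iterate of `T` is a translation on a short interval to the right of any point. -/
lemma exists_iterate_translation (k : ℕ) {a : ℝ} (ha : a ∈ unitIco) :
    ∃ ε > 0, a + ε ≤ 1 ∧ ∀ v ∈ Ico a (a + ε), T.f^[k] v = T.f^[k] a + (v - a) := by
  induction k with
  | zero => exact ⟨1 - a, sub_pos.mpr ha.2, by linarith, fun v _ => by simp⟩
  | succ k ih =>
    obtain ⟨ε, hε, hε₁, htr⟩ := ih
    obtain ⟨i, hi⟩ := T.exists_mem_Ico (T.mapsTo_f_unitIco.iterate k ha)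
    refine ⟨min ε (T.beta i.succ - T.f^[k] a), lt_min hε (sub_pos.mpr hi.2),
      by linarith [min_le_left ε (T.beta i.succ - T.f^[k] a)], fun v hv => ?_⟩
    have hv₁ : v - a < ε := by linarith [hv.2, min_le_left ε (T.beta i.succ - T.f^[k] a)]
    have hv₂ : v - a < T.beta i.succ - T.f^[k] a := by
      linarith [hv.2, min_le_right ε (T.beta i.succ - T.f^[k] a)]
    rw [Function.iterate_succ_apply', Function.iterate_succ_apply',
      htr v ⟨hv.1, by linarith⟩, T.f_eq hi,
      T.f_eq (x := T.f^[k] a + (v - a)) ⟨by linarith [hi.1, hv.1], by linarith⟩]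
    ring

lemma finite_critSet : T.critSet.Finite := by
  refine (Set.finite_range T.beta).subset ?_
  rintro _ ⟨i, -, -, rfl⟩
  exact mem_range_self i

end Basic

section Attractor

variable (T : ITM r)

lemma Xn_succ (n : ℕ) : T.Xn (n + 1) = T.f '' T.Xn n := by
  rw [Xn, Xn, Function.iterate_succ', image_comp]

lemma X_subset_unitIco : T.X ⊆ unitIco := by
  intro x hx
  simpa [Xn] using mem_iInter.mp hx 0

lemma antitone_Xn : Antitone T.Xn := by
  refine antitone_nat_of_succ_le fun n => ?_
  rw [Xn, Xn, Function.iterate_succ, image_comp]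
  exact image_mono T.mapsTo_f_unitIco.image_subset

lemma mem_X_of_periodic {n : ℕ} (hn : 0 < n) {y : ℝ} (hy : y ∈ unitIco)
    (hper : T.f^[n] y = y) : y ∈ T.X := by
  refine mem_iInter.mpr fun k => ?_
  refine T.antitone_Xn (Nat.le_mul_of_pos_left k hn) ⟨y, hy, ?_⟩
  rw [Function.iterate_mul]
  exact Function.iterate_fixed hper k

variable {T}

lemma FiniteType.exists_X_eq (hft : T.FiniteType) :
    ∃ n, T.X = T.Xn n ∧ T.Xn (n + 1) = T.Xn n := by
  obtain ⟨n, hn⟩ := hft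
  have hstab : ∀ k, T.Xn (n + k) = T.Xn n := by
    intro k
    induction k with
    | zero => rfl
    | succ k ih => rw [← add_assoc, Xn_succ, ih, ← Xn_succ, hn]
  refine ⟨n, Subset.antisymm (iInter_subset _ n) (subset_iInter fun k => ?_), hn⟩
  rw [← hstab k]
  exact T.antitone_Xn (Nat.le_add_left k n)

lemma FiniteType.image_X (hft : T.FiniteType) : T.f '' T.X = T.X := by
  obtain ⟨n, hX, hn⟩ := hft.exists_X_eq
  rw [hX, ← Xn_succ, hn]

lemma FiniteType.mapsTo_X (hft : T.FiniteType) : MapsTo T.f T.X T.X := by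
  intro x hx
  rw [← hft.image_X]
  exact mem_image_of_mem _ hx

lemma FiniteType.exists_Ico_subset_X (hft : T.FiniteType) {a : ℝ} (ha : a ∈ T.X) :
    ∃ ε > 0, Ico a (a + ε) ⊆ T.X := by
  obtain ⟨n, hX, -⟩ := hft.exists_X_eq
  rw [hX] at ha ⊢
  obtain ⟨b, hb, rfl⟩ := ha
  obtain ⟨ε, hε, hε₁, htr⟩ := T.exists_iterate_translation n hb
  refine ⟨ε, hε, fun p hp => ⟨b + (p - T.f^[n] b), ?_, ?_⟩⟩
  · exact ⟨by linarith [hb.1, hp.1], by linarith [hp.2]⟩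
  · rw [htr _ ⟨by linarith [hp.1], by linarith [hp.2]⟩]
    ring

end Attractor

section Measure

variable (T : ITM r)

lemma image_eq_iUnion {A : Set ℝ} (hA : A ⊆ unitIco) :
    T.f '' A = ⋃ i : Fin r,
      (fun x => x + T.gamma i) '' (A ∩ Ico (T.beta i.castSucc) (T.beta i.succ)) := by
  ext y
  simp only [mem_image, mem_iUnion]
  constructor
  · rintro ⟨x, hx, rfl⟩
    obtain ⟨i, hi⟩ := T.exists_mem_Ico (hA hx)
    exact ⟨i, x, ⟨hx, hi⟩, (T.f_eq hi).symm⟩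
  · rintro ⟨i, x, ⟨hx, hi⟩, rfl⟩
    exact ⟨x, hx, T.f_eq hi⟩

lemma measurableSet_image {A : Set ℝ} (hA : A ⊆ unitIco) (hm : MeasurableSet A) :
    MeasurableSet (T.f '' A) := by
  rw [T.image_eq_iUnion hA]
  refine MeasurableSet.iUnion fun i => ?_
  exact (measurableEmbedding_addRight (T.gamma i)).measurableSet_image.mpr
    (hm.inter measurableSet_Ico)

lemma volume_image_le {A : Set ℝ} (hA : A ⊆ unitIco) (hm : MeasurableSet A) :
    volume (T.f '' A) ≤ volume A := by
  rw [T.image_eq_iUnion hA]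
  have hdisj : Pairwise (Function.onFun Disjoint fun i : Fin r =>
      A ∩ Ico (T.beta i.castSucc) (T.beta i.succ)) := by
    intro i j hij
    refine disjoint_left.mpr fun x hi hj => hij (T.Ico_index_unique hi.2 hj.2)
  calc _ ≤ ∑ i : Fin r, volume ((fun x => x + T.gamma i) ''
        (A ∩ Ico (T.beta i.castSucc) (T.beta i.succ))) := measure_iUnion_fintype_le _ _
    _ = ∑ i : Fin r, volume (A ∩ Ico (T.beta i.castSucc) (T.beta i.succ)) := by
        simp only [image_add_right, measure_preimage_add_right]
    _ = volume (⋃ i : Fin r, A ∩ Ico (T.beta i.castSucc) (T.beta i.succ)) := by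
        rw [measure_iUnion hdisj fun i => hm.inter measurableSet_Ico, tsum_fintype]
    _ ≤ volume A := measure_mono (iUnion_subset fun i => inter_subset_left)

lemma measurable_f : Measurable T.f := by
  intro A hA
  have : T.f ⁻¹' A = (A \ unitIco) ∪ ⋃ i : Fin r,
      (Ico (T.beta i.castSucc) (T.beta i.succ) ∩ (fun x => x + T.gamma i) ⁻¹' A) := by
    ext x
    simp only [mem_preimage, mem_union, mem_iUnion, mem_inter_iff, Set.mem_sdiff]
    constructor
    · intro hx
      by_cases hu : x ∈ unitIco
      · obtain ⟨i, hi⟩ := T.exists_mem_Ico hu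
        exact Or.inr ⟨i, hi, T.f_eq hi ▸ hx⟩
      · rw [f, if_neg hu] at hx
        exact Or.inl ⟨hx, hu⟩
    · rintro (⟨hx, hu⟩ | ⟨i, hi, hx⟩)
      · rwa [f, if_neg hu]
      · rwa [T.f_eq hi]
  rw [this]
  refine (hA.diff measurableSet_Ico).union (MeasurableSet.iUnion fun i => ?_)
  exact measurableSet_Ico.inter ((measurable_id.add_const _) hA)

lemma measurableSet_X : MeasurableSet T.X := by
  refine MeasurableSet.iInter fun n => ?_
  induction n with
  | zero => simp [Xn, unitIco]
  | succ n ih =>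
    rw [Xn_succ]
    exact T.measurableSet_image (T.mapsTo_f_unitIco.iterate n).image_subset ih

lemma volume_X_ne_top : volume T.X ≠ ⊤ :=
  ((measure_mono T.X_subset_unitIco).trans_lt (measure_Ico_lt_top (a := 0) (b := 1))).ne

variable {T}

lemma FiniteType.measurePreserving (hft : T.FiniteType) :
    MeasurePreserving T.f (volume.restrict T.X) (volume.restrict T.X) := by
  have hle : ∀ A : Set ℝ, MeasurableSet A → volume (A ∩ T.X) ≤ volume (T.f ⁻¹' A ∩ T.X) := by
    intro A hA
    have hsub : T.f ⁻¹' A ∩ T.X ⊆ unitIco := inter_subset_right.trans T.X_subset_unitIco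
    refine (measure_mono ?_).trans
      (T.volume_image_le hsub ((T.measurable_f hA).inter T.measurableSet_X))
    rintro y ⟨hyA, hyX⟩
    rw [← hft.image_X] at hyX
    obtain ⟨x, hx, rfl⟩ := hyX
    exact ⟨x, ⟨hyA, hx⟩, rfl⟩
  refine ⟨T.measurable_f, Measure.ext fun A hA => ?_⟩
  rw [Measure.map_apply T.measurable_f hA, Measure.restrict_apply (T.measurable_f hA),
    Measure.restrict_apply hA]
  refine le_antisymm ?_ (hle A hA)
  have h₁ := measure_inter_add_sdiff (μ := volume) T.X hA
  have h₂ := measure_inter_add_sdiff (μ := volume) T.X (T.measurable_f hA)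
  have h₃ := hle Aᶜ hA.compl
  rw [sdiff_eq, inter_comm, inter_comm T.X] at h₁ h₂
  rw [preimage_compl] at h₃
  have hfin : volume (Aᶜ ∩ T.X) ≠ ⊤ :=
    ((measure_mono inter_subset_right).trans_lt T.volume_X_ne_top.lt_top).ne
  refine (ENNReal.add_le_add_iff_right hfin).mp ?_
  rw [h₁, ← h₂]
  gcongr

lemma FiniteType.injOn_X (hft : T.FiniteType) : InjOn T.f T.X := by
  have key : ∀ p ∈ T.X, ∀ q ∈ T.X, p < q → T.f p ≠ T.f q := by
    intro p hp q hq hpq heq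
    obtain ⟨ε₁, hε₁, hX₁⟩ := hft.exists_Ico_subset_X hp
    obtain ⟨ε₂, hε₂, hX₂⟩ := hft.exists_Ico_subset_X hq
    obtain ⟨ε₃, hε₃, -, ht₃⟩ := T.exists_iterate_translation 1 (T.X_subset_unitIco hp)
    obtain ⟨ε₄, hε₄, -, ht₄⟩ := T.exists_iterate_translation 1 (T.X_subset_unitIco hq)
    simp only [Function.iterate_one] at ht₃ ht₄
    obtain ⟨ε, hε, hεlt⟩ := exists_between (show (0 : ℝ) <
      min (min ε₁ ε₂) (min (min ε₃ ε₄) (q - p)) from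
      lt_min (lt_min hε₁ hε₂) (lt_min (lt_min hε₃ hε₄) (sub_pos.mpr hpq)))
    simp only [lt_min_iff] at hεlt
    obtain ⟨⟨h₁, h₂⟩, ⟨h₃, h₄⟩, h₅⟩ := hεlt
    have hmp := hft.measurePreserving.measure_preimage (measurableSet_Ico (a := T.f p)
      (b := T.f p + ε)).nullMeasurableSet
    rw [Measure.restrict_apply (T.measurable_f measurableSet_Ico),
      Measure.restrict_apply measurableSet_Ico] at hmp
    have hsub : Ico p (p + ε) ∪ Ico q (q + ε) ⊆ T.f ⁻¹' Ico (T.f p) (T.f p + ε) ∩ T.X := by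
      rintro v (hv | hv)
      · refine ⟨?_, hX₁ ⟨hv.1, by linarith [hv.2]⟩⟩
        rw [mem_preimage, ht₃ v ⟨hv.1, by linarith [hv.2]⟩]
        exact ⟨by linarith [hv.1], by linarith [hv.2]⟩
      · refine ⟨?_, hX₂ ⟨hv.1, by linarith [hv.2]⟩⟩
        rw [mem_preimage, ht₄ v ⟨hv.1, by linarith [hv.2]⟩, ← heq]
        exact ⟨by linarith [hv.1], by linarith [hv.2]⟩
    have hdisj : Disjoint (Ico p (p + ε)) (Ico q (q + ε)) :=
      disjoint_left.mpr fun v hv hv' => by linarith [hv.2, hv'.1]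
    have hle := (measure_mono hsub).trans (hmp.le.trans (measure_mono inter_subset_left))
    rw [measure_union hdisj measurableSet_Ico, Real.volume_Ico, Real.volume_Ico,
      Real.volume_Ico, ← ENNReal.ofReal_add (by linarith) (by linarith),
      ENNReal.ofReal_le_ofReal_iff (by linarith)] at hle
    linarith
  intro p hp q hq heq
  rcases lt_trichotomy p q with h | h | h
  · exact absurd heq (key p hp q hq h)
  · exact h
  · exact absurd heq.symm (key q hq p hp h)

/-- Poincaré recurrence in a one-sided neighbourhood contained in `X`. -/
lemma FiniteType.exists_recurrent (hft : T.FiniteType) {c ε : ℝ} (hε : 0 < ε)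
    (hs : Ico c (c + ε) ⊆ T.X) :
    ∃ u ∈ Ioo c (c + ε), ∀ N, ∃ n ≥ N, T.f^[n] u ∈ Ioo c (c + ε) := by
  have : IsFiniteMeasure (volume.restrict T.X) :=
    ⟨by simpa using T.volume_X_ne_top.lt_top⟩
  have hcons := hft.measurePreserving.conservative
  have hae := hcons.ae_mem_imp_frequently_image_mem
    (measurableSet_Ioo (a := c) (b := c + ε)).nullMeasurableSet
  by_contra! hcon
  have hzero : volume.restrict T.X (Ioo c (c + ε)) = 0 := by
    refine measure_mono_null ?_ (ae_iff.mp hae)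
    intro u hu
    obtain ⟨N, hN⟩ := hcon u hu
    simp only [mem_ofPred_eq, Classical.not_imp, Filter.not_frequently]
    exact ⟨hu, Filter.eventually_atTop.mpr ⟨N, hN⟩⟩
  rw [Measure.restrict_apply measurableSet_Ioo,
    inter_eq_left.mpr (Ioo_subset_Ico_self.trans hs), Real.volume_Ioo] at hzero
  simp at hzero
  linarith

end Measure

end ITM

namespace ITM

variable {r : ℕ} {T : ITM r}

section Components

lemma IsIntervalComponent.subset_X {J : Set ℝ} (hJ : T.IsIntervalComponent J) : J ⊆ T.X := by
  obtain ⟨⟨z, -, rfl⟩, -⟩ := hJ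
  exact connectedComponentIn_subset _ _

lemma IsIntervalComponent.Icc_subset {J : Set ℝ} (hJ : T.IsIntervalComponent J) {p q v : ℝ}
    (hX : Icc p q ⊆ T.X) (hv : v ∈ Icc p q) (hvJ : v ∈ J) : Icc p q ⊆ J := by
  obtain ⟨⟨z, -, rfl⟩, -⟩ := hJ
  rw [connectedComponentIn_eq hvJ]
  exact isPreconnected_Icc.subset_connectedComponentIn hv hX

lemma IsIntervalComponent.eq_of_mem {J J' : Set ℝ} (hJ : T.IsIntervalComponent J)
    (hJ' : T.IsIntervalComponent J') {a : ℝ} (ha : a ∈ J) (ha' : a ∈ J') : J = J' := by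
  obtain ⟨⟨z, -, rfl⟩, -⟩ := hJ
  obtain ⟨⟨z', -, rfl⟩, -⟩ := hJ'
  rw [connectedComponentIn_eq ha, connectedComponentIn_eq ha']

/-- An iterate acting as a translation on an interval in `X` sends it into a component as soon
as it sends one of its points there. -/
lemma IsIntervalComponent.iterate_mem (hft : T.FiniteType) {J : Set ℝ}
    (hJ : T.IsIntervalComponent J) {a u v w : ℝ} {i : ℕ} (hX : Icc a u ⊆ T.X)
    (htr : ∀ v ∈ Icc a u, T.f^[i] v = T.f^[i] a + (v - a))
    (hv : v ∈ Icc a u) (hw : w ∈ Icc a u) (hvJ : T.f^[i] v ∈ J) : T.f^[i] w ∈ J := by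
  have hau : a ≤ u := hv.1.trans hv.2
  have himg : Icc (T.f^[i] a) (T.f^[i] u) ⊆ T.X := by
    intro p hp
    rw [htr u ⟨hau, le_rfl⟩] at hp
    have hmem : a + (p - T.f^[i] a) ∈ Icc a u := ⟨by linarith [hp.1], by linarith [hp.2]⟩
    have := hft.mapsTo_X.iterate i (hX hmem)
    rwa [htr _ hmem, show T.f^[i] a + (a + (p - T.f^[i] a) - a) = p by ring] at this
  have hmem : ∀ v ∈ Icc a u, T.f^[i] v ∈ Icc (T.f^[i] a) (T.f^[i] u) := by
    intro v hv
    rw [htr v hv, htr u ⟨hau, le_rfl⟩]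
    exact ⟨by linarith [hv.1], by linarith [hv.2]⟩
  exact hJ.Icc_subset himg (hmem v hv) hvJ (hmem w hw)

variable (T) in
/-- The points which land on a discontinuity before returning to `J`. -/
def earlyCrit (J : Set ℝ) : Set ℝ :=
  {v | ∃ k, T.f^[k] v ∈ T.critSet ∧ ∀ i, 0 < i → i ≤ k → T.f^[i] v ∉ J}

/-- An interval in a component without points of `earlyCrit` beyond its left end is translated
rigidly for as long as one of its points does not return. -/
lemma IsIntervalComponent.translation (hft : T.FiniteType) {J : Set ℝ}
    (hJ : T.IsIntervalComponent J) {a u b : ℝ} {n : ℕ} (hau : Icc a u ⊆ J)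
    (hD : ∀ v ∈ Ioc a u, v ∉ T.earlyCrit J) (hb : b ∈ Icc a u)
    (hret : ∀ i, 0 < i → i < n → T.f^[i] b ∉ J) :
    ∀ i ≤ n, ∀ v ∈ Icc a u, T.f^[i] v = T.f^[i] a + (v - a) := by
  intro i
  induction i using Nat.strong_induction_on with
  | _ i ih =>
    intro hin v hv
    rcases i with _ | i
    · simp
    have htr : ∀ j ≤ i, ∀ v ∈ Icc a u, T.f^[j] v = T.f^[j] a + (v - a) :=
      fun j hj => ih j (by omega) (by omega)
    have hX : Icc a u ⊆ T.X := hau.trans hJ.subset_X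
    have hunit : ∀ v ∈ Icc a u, T.f^[i] v ∈ unitIco := fun v hv =>
      T.X_subset_unitIco (hft.mapsTo_X.iterate i (hX hv))
    have hu : u ∈ Icc a u := ⟨hv.1.trans hv.2, le_rfl⟩
    have ha : a ∈ Icc a u := ⟨le_rfl, hv.1.trans hv.2⟩
    have hcrit : ∀ w ∈ Ioc (T.f^[i] a) (T.f^[i] u), w ∉ T.critSet := by
      intro w hw hwc
      rw [htr i le_rfl u hu] at hw
      have hw' : a + (w - T.f^[i] a) ∈ Ioc a u := ⟨by linarith [hw.1], by linarith [hw.2]⟩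
      refine hD _ hw' ⟨i, ?_, fun j hj hji hjJ => ?_⟩
      · rwa [htr i le_rfl _ (Ioc_subset_Icc_self hw'),
          show T.f^[i] a + (a + (w - T.f^[i] a) - a) = w by ring]
      · exact hret j hj (by omega)
          (hJ.iterate_mem hft hX (htr j hji) (Ioc_subset_Icc_self hw') hb hjJ)
    have hstep := T.f_eq_of_no_crit (v := T.f^[i] v) (hunit a ha).1 (hunit u hu).2 hcrit (by
      rw [htr i le_rfl v hv, htr i le_rfl u hu]
      exact ⟨by linarith [hv.1], by linarith [hv.2]⟩)
    rw [Function.iterate_succ_apply', Function.iterate_succ_apply', hstep, htr i le_rfl v hv]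
    ring

lemma FiniteType.iterate_injOn_X (hft : T.FiniteType) (k : ℕ) : InjOn T.f^[k] T.X :=
  hft.injOn_X.iterate hft.mapsTo_X k

lemma IsIntervalComponent.finite_earlyCrit (hft : T.FiniteType) {J : Set ℝ}
    (hJ : T.IsIntervalComponent J) : (J ∩ T.earlyCrit J).Finite := by
  have hex : ∀ v, ∃ k, v ∈ J ∩ T.earlyCrit J →
      T.f^[k] v ∈ T.critSet ∧ ∀ i, 0 < i → i ≤ k → T.f^[i] v ∉ J := by
    intro v
    by_cases hv : v ∈ J ∩ T.earlyCrit J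
    · obtain ⟨k, hk⟩ := hv.2
      exact ⟨k, fun _ => hk⟩
    · exact ⟨0, fun h => absurd h hv⟩
  choose k hk using hex
  have key : ∀ v ∈ J ∩ T.earlyCrit J, ∀ w ∈ J ∩ T.earlyCrit J, k v ≤ k w →
      T.f^[k v] v = T.f^[k w] w → v = w := by
    intro v hv w hw hle heq
    obtain ⟨m, hm⟩ := Nat.exists_eq_add_of_le hle
    rw [hm, Function.iterate_add_apply] at heq
    have hvw : v = T.f^[m] w := hft.iterate_injOn_X (k v) (hJ.subset_X hv.1)
      (hft.mapsTo_X.iterate m (hJ.subset_X hw.1)) heq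
    rcases Nat.eq_zero_or_pos m with rfl | hmpos
    · exact hvw
    · exact absurd (hvw ▸ hv.1) ((hk w hw).2 m hmpos (by omega))
  refine Set.Finite.of_injOn (f := fun v => T.f^[k v] v) (fun v hv => (hk v hv).1) ?_
    T.finite_critSet
  intro v hv w hw heq
  rcases le_total (k v) (k w) with h | h
  · exact key v hv w hw h heq
  · exact (key w hw v hv h heq.symm).symm

/-- Every point of an interval component returns to it. -/
lemma IsIntervalComponent.exists_return (hft : T.FiniteType) {J : Set ℝ}
    (hJ : T.IsIntervalComponent J) {a : ℝ} (ha : a ∈ J) : ∃ n, 0 < n ∧ T.f^[n] a ∈ J := by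
  obtain ⟨x, y, hxy, hJeq⟩ := hJ.2
  have hfin : ((J ∩ T.earlyCrit J) \ {a}).Finite := (hJ.finite_earlyCrit hft).subset sdiff_subset
  obtain ⟨ε, hε, hball⟩ := Metric.isOpen_iff.mp hfin.isClosed.isOpen_compl a (by simp)
  have hya : a < y := (hJeq ▸ ha : a ∈ Ico x y).2
  have hxa : x ≤ a := (hJeq ▸ ha : a ∈ Ico x y).1
  set δ := min ε (y - a)
  have hδpos : 0 < δ := lt_min hε (by linarith)
  have hδε : δ ≤ ε := min_le_left _ _
  have hδy : δ ≤ y - a := min_le_right _ _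
  have hsub : Ico a (a + δ) ⊆ J := by
    rw [hJeq]
    exact fun v hv => ⟨hxa.trans hv.1, by linarith [hv.2]⟩
  obtain ⟨u, hu, hrec⟩ := hft.exists_recurrent hδpos (hsub.trans hJ.subset_X)
  have hexu : ∃ n, 0 < n ∧ T.f^[n] u ∈ J := by
    obtain ⟨n, hn, hmem⟩ := hrec 1
    exact ⟨n, hn, hsub (Ioo_subset_Ico_self hmem)⟩
  have hau : Icc a u ⊆ J := fun v hv => hsub ⟨hv.1, hv.2.trans_lt hu.2⟩
  have hmemu : u ∈ Icc a u := ⟨hu.1.le, le_rfl⟩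
  have htr := hJ.translation hft (n := Nat.find hexu) hau (fun v hv hvD => by
      have hvball : v ∈ Metric.ball a ε := by
        rw [Metric.mem_ball, Real.dist_eq, abs_of_pos (sub_pos.mpr hv.1)]
        linarith [hv.2, hu.2]
      exact hball hvball ⟨⟨hau (Ioc_subset_Icc_self hv), hvD⟩, hv.1.ne'⟩)
    hmemu (fun i hi hin hmem => Nat.find_min hexu hin ⟨hi, hmem⟩)
  refine ⟨Nat.find hexu, (Nat.find_spec hexu).1, ?_⟩
  exact hJ.iterate_mem hft (hau.trans hJ.subset_X) (htr _ le_rfl) hmemu ⟨le_rfl, hu.1.le⟩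
    (Nat.find_spec hexu).2

lemma IsIntervalComponent.exists_return_ge (hft : T.FiniteType) {J : Set ℝ}
    (hJ : T.IsIntervalComponent J) {a : ℝ} (ha : a ∈ J) (N : ℕ) :
    ∃ n ≥ N, T.f^[n] a ∈ J := by
  induction N with
  | zero => exact ⟨0, le_rfl, ha⟩
  | succ N ih =>
    obtain ⟨n, hn, hmem⟩ := ih
    obtain ⟨m, hm, hmem'⟩ := hJ.exists_return hft hmem
    rw [← Function.iterate_add_apply] at hmem'
    exact ⟨m + n, by omega, hmem'⟩

lemma IsIntervalComponent.lt_returnTime_iff (hft : T.FiniteType) {J : Set ℝ}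
    (hJ : T.IsIntervalComponent J) {a : ℝ} (ha : a ∈ J) {k : ℕ} :
    k < T.returnTime J a ↔ ∀ i, 0 < i → i ≤ k → T.f^[i] a ∉ J := by
  have hmem := Nat.sInf_mem (s := {k : ℕ | 0 < k ∧ T.f^[k] a ∈ J}) (hJ.exists_return hft ha)
  constructor
  · intro hk i hi hik hiJ
    exact Nat.notMem_of_lt_sInf (hik.trans_lt hk) ⟨hi, hiJ⟩
  · intro h
    by_contra! hle
    exact h _ hmem.1 hle hmem.2

/-- The last visit to `J` before time `N` of an orbit which starts in `J`. -/
lemma exists_last_visit {J : Set ℝ} {b : ℝ} (hb : b ∈ J) (N : ℕ) :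
    ∃ m, ∃ a ∈ J, T.f^[m] a = T.f^[N] b ∧ ∀ i, 0 < i → i ≤ m → T.f^[i] a ∉ J := by
  induction N with
  | zero => exact ⟨0, b, hb, rfl, fun i hi hi' => by omega⟩
  | succ N ih =>
    by_cases hmem : T.f^[N + 1] b ∈ J
    · exact ⟨0, _, hmem, rfl, fun i hi hi' => by omega⟩
    · obtain ⟨m, a, ha, heq, hret⟩ := ih
      have heq' : T.f^[m + 1] a = T.f^[N + 1] b := by
        rw [Function.iterate_succ_apply', heq, Function.iterate_succ_apply']
      refine ⟨m + 1, a, ha, heq', fun i hi hi' => ?_⟩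
      rcases Nat.lt_or_ge m i with h | h
      · rwa [show i = m + 1 by omega, heq']
      · exact hret i hi h

end Components

section CriticalComponents

/-- An interval component `[x, y)` of `X` in which the discontinuity `c` is the only point that
lands on a discontinuity before returning, and `c` meets no other discontinuity on the way. -/
structure IsCritComponent (T : ITM r) (x y c : ℝ) : Prop where
  comp : T.IsIntervalComponent (Ico x y)
  mem : c ∈ Ico x y
  eq_of_early : ∀ v ∈ Ico x y, v ∈ T.earlyCrit (Ico x y) → v = c
  iterate_eq : ∀ k, T.f^[k] c ∈ T.critSet →
    (∀ i, 0 < i → i ≤ k → T.f^[i] c ∉ Ico x y) → T.f^[k] c = c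

lemma sf_iterate_true (k : ℕ) (x : ℝ) : T.sf^[k] (x, true) = (T.f^[k] x, true) := by
  induction k with
  | zero => rfl
  | succ k ih => simp [Function.iterate_succ_apply', ih, sf]

lemma sf_iterate_false (k : ℕ) (x : ℝ) : T.sf^[k] (x, false) = (T.fm^[k] x, false) := by
  induction k with
  | zero => rfl
  | succ k ih => simp [Function.iterate_succ_apply', ih, sf]

lemma sReturnTime_true (x y a : ℝ) :
    T.sReturnTime x y (a, true) = T.returnTime (Ico x y) a := by
  simp [sReturnTime, returnTime, sf_iterate_true, smem]

lemma mem_earlyCrit_of_mem_critSet {J : Set ℝ} {c : ℝ} (hc : c ∈ T.critSet) :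
    c ∈ T.earlyCrit J :=
  ⟨0, hc, fun i hi hi' => by omega⟩

lemma IsIntervalComponent.isCritComponent (hft : T.FiniteType) (h1 : T.A1) (h2 : T.A2)
    (hm : T.Matching) {x y c : ℝ} (hJ : T.IsIntervalComponent (Ico x y))
    (hcJ : c ∈ Ico x y) (hc : c ∈ T.critSet) : T.IsCritComponent x y c := by
  have hearly : ∀ v ∈ Ico x y, v ∈ T.earlyCrit (Ico x y) ↔
      ∃ k < T.returnTime (Ico x y) v, T.f^[k] v ∈ T.critSet := by
    intro v hv
    constructor
    · rintro ⟨k, hk, hret⟩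
      exact ⟨k, (hJ.lt_returnTime_iff hft hv).mpr hret, hk⟩
    · rintro ⟨k, hlt, hk⟩
      exact ⟨k, hk, (hJ.lt_returnTime_iff hft hv).mp hlt⟩
  refine ⟨hJ, hcJ, ?_, ?_⟩
  · intro v hv hvD
    by_cases htriv : T.DynTrivial (Ico x y)
    · have key : ∀ w ∈ Ico x y, w ∈ T.earlyCrit (Ico x y) → w = x := by
        rintro w hw ⟨k, hk, -⟩
        by_contra hne
        refine htriv.2.1 w ?_ ⟨k, hk⟩
        rw [interior_Ico]
        exact ⟨lt_of_le_of_ne hw.1 (Ne.symm hne), hw.2⟩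
      rw [key v hv hvD, key c hcJ (mem_earlyCrit_of_mem_critSet hc)]
    · have key : ∀ w ∈ Ico x y, w ∈ T.earlyCrit (Ico x y) → w ∈ interior (Ico x y) := by
        intro w hw hwD
        rw [interior_Ico]
        refine ⟨lt_of_le_of_ne hw.1 ?_, hw.2⟩
        rintro rfl
        obtain ⟨k, hlt, hk⟩ := (hearly _ hw).mp hwD
        refine (h2 _ _ hJ htriv).1 k (by rwa [sReturnTime_true]) ?_
        rw [sf_iterate_true]
        exact hk
      have hcD := mem_earlyCrit_of_mem_critSet (J := Ico x y) hc
      exact (hm _ hJ htriv).unique ⟨key v hv hvD, (hearly v hv).mp hvD⟩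
        ⟨key c hcJ hcD, (hearly c hcJ).mp hcD⟩
  · intro k hk hret
    have hlt := (hJ.lt_returnTime_iff hft hcJ).mpr hret
    exact h1 _ hJ c hcJ ⟨hk, k, hlt, rfl⟩ ⟨hc, 0, by omega, rfl⟩

lemma IsCritComponent.notMem_earlyCrit_right {x y c u : ℝ} (h : T.IsCritComponent x y c)
    (hu : u < y) : ∀ v ∈ Ioc c u, v ∉ T.earlyCrit (Ico x y) := fun v hv hvD =>
  hv.1.ne' (h.eq_of_early v ⟨h.mem.1.trans hv.1.le, hv.2.trans_lt hu⟩ hvD)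

lemma IsCritComponent.notMem_earlyCrit_left {x y c u : ℝ} (h : T.IsCritComponent x y c)
    (hu : u < c) : ∀ v ∈ Ioc x u, v ∉ T.earlyCrit (Ico x y) := fun v hv hvD =>
  (hv.2.trans_lt hu).ne (h.eq_of_early v ⟨hv.1.le, (hv.2.trans_lt hu).trans h.mem.2⟩ hvD)

/-- The forward orbit of a critical component contains no discontinuity but its own. -/
lemma IsCritComponent.iterate_ne_crit {x y c c' : ℝ} (h : T.IsCritComponent x y c)
    (hc' : c' ∈ T.critSet) (hne : c' ≠ c) {b : ℝ} (hb : b ∈ Ico x y) (N : ℕ) :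
    T.f^[N] b ≠ c' := by
  intro heq
  obtain ⟨m, a, ha, hma, hret⟩ := exists_last_visit (T := T) hb N
  rw [heq] at hma
  obtain rfl := h.eq_of_early a ha ⟨m, hma ▸ hc', hret⟩
  exact hne (hma ▸ h.iterate_eq m (hma ▸ hc') hret)

/-- The orbit of one discontinuity in `X` does not visit another critical component. -/
lemma IsCritComponent.iterate_crit_notMem (hft : T.FiniteType) {x y c c' : ℝ}
    (h : T.IsCritComponent x y c) (hc' : c' ∈ T.critSet) (hne : c' ≠ c) (hX : c' ∈ T.X)
    (k : ℕ) : T.f^[k] c' ∉ Ico x y := by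
  intro hk
  obtain ⟨ε₁, hε₁, hX₁⟩ := hft.exists_Ico_subset_X hX
  obtain ⟨ε₂, hε₂, -, htr⟩ := T.exists_iterate_translation k (T.X_subset_unitIco hX)
  set M := T.returnTime (Ico x y) x + T.returnTime (Ico x y) c with hM
  have hev : ∀ q : ℝ, ∀ᶠ δ in nhdsWithin (0 : ℝ) (Ioi 0), q < c' + δ → q ≤ c' := by
    intro q
    rcases le_or_gt q c' with hq | hq
    · exact Eventually.of_forall fun _ _ => hq
    · filter_upwards [Ioo_mem_nhdsGT (sub_pos.mpr hq)] with δ hδ hlt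
      linarith [hδ.2]
  have hev' : ∀ᶠ δ in nhdsWithin (0 : ℝ) (Ioi 0), ∀ i ∈ Finset.range M, ∀ e ∈ ({x, c} : Finset ℝ),
      T.f^[i] e < c' + δ → T.f^[i] e ≤ c' := by
    simp only [Filter.eventually_all_finset]
    exact fun i _ e _ => hev _
  obtain ⟨ε, hsep, hε⟩ := (hev'.and (Ioo_mem_nhdsGT (lt_min (lt_min hε₁ hε₂)
    (sub_pos.mpr hk.2)))).exists
  have hε' := hε.2
  simp only [lt_min_iff] at hε'
  obtain ⟨⟨hε₁', hε₂'⟩, hε₃'⟩ := hε'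
  obtain ⟨u, hu, hrec⟩ := hft.exists_recurrent hε.1
    (fun v hv => hX₁ ⟨hv.1, by linarith [hv.2]⟩ : Ico c' (c' + ε) ⊆ T.X)
  have huJ : T.f^[k] u ∈ Ico x y := by
    rw [htr u ⟨hu.1.le, by linarith [hu.2]⟩]
    exact ⟨by linarith [hk.1, hu.1], by linarith [hu.2]⟩
  obtain ⟨n, hn, hnu⟩ := hrec k
  obtain ⟨N, rfl⟩ := Nat.exists_eq_add_of_le' hn
  rw [Function.iterate_add_apply] at hnu
  obtain ⟨m, b, hb, hmb, hret⟩ := exists_last_visit (T := T) huJ N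
  rw [← hmb] at hnu
  have hfinish : ∀ e ∈ ({x, c} : Finset ℝ), e ∈ Ico x y → e ≤ b →
      (∀ v ∈ Ioc e b, v ∉ T.earlyCrit (Ico x y)) → False := by
    intro e he heJ heb hD
    have hsub : Icc e b ⊆ Ico x y := fun v hv => ⟨heJ.1.trans hv.1, hv.2.trans_lt hb.2⟩
    have hbm : b ∈ Icc e b := ⟨heb, le_rfl⟩
    have hem : e ∈ Icc e b := ⟨le_rfl, heb⟩
    have htr' := h.comp.translation hft (n := m) hsub hD hbm
      (fun i hi him => hret i hi him.le)
    have hlt : m < T.returnTime (Ico x y) e :=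
      (h.comp.lt_returnTime_iff hft heJ).mpr fun i hi him hiJ => hret i hi him
        (h.comp.iterate_mem hft (hsub.trans h.comp.subset_X) (htr' i him) hem hbm hiJ)
    have hmM : m ∈ Finset.range M := by
      rw [Finset.mem_range]
      rcases Finset.mem_insert.mp he with rfl | he
      · omega
      · obtain rfl := Finset.mem_singleton.mp he
        omega
    have hmb' := htr' m le_rfl b hbm
    have hle := hsep m hmM e he (by linarith [hnu.2])
    have hmem : e + (c' - T.f^[m] e) ∈ Icc e b := ⟨by linarith, by linarith [hnu.1]⟩
    refine h.iterate_ne_crit hc' hne (hsub hmem) m ?_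
    rw [htr' m le_rfl _ hmem]
    ring
  rcases lt_or_ge b c with hbc | hbc
  · exact hfinish x (by simp) ⟨le_rfl, hb.1.trans_lt hb.2⟩ hb.1 (h.notMem_earlyCrit_left hbc)
  · exact hfinish c (by simp) h.mem hbc (h.notMem_earlyCrit_right hb.2)

/-- If a critical component is linked to a set `J'` which is not reached from its discontinuity,
then some iterate of the discontinuity bounds on the left an interval, ending at `1`, all of whose
points reach the component. -/
lemma IsCritComponent.exists_tail_visits (hft : T.FiniteType) (h2 : T.A2) {x y c : ℝ}
    (h : T.IsCritComponent x y c) (hc : c ∈ T.critSet) {J' : Set ℝ}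
    (hJ' : T.IsIntervalComponent J') (hcJ' : ∀ k, T.f^[k] c ∉ J')
    {b : ℝ} (hb : b ∈ Ico x y) {N : ℕ} (hbN : T.f^[N] b ∈ J') :
    ∃ k, ∀ p, T.f^[k] c ≤ p → p < 1 → ∃ i, T.f^[i] p ∈ Ico x y := by
  have hX := h.comp.subset_X
  have hleft : x < c ∧ ∀ v ∈ Ico x c, ∃ m, T.f^[m] v ∈ J' := by
    obtain ⟨m, a, ha, hma, hret⟩ := exists_last_visit (T := T) hb N
    rw [← hma] at hbN
    have hac : a < c := by
      by_contra! hca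
      have hsub : Icc c a ⊆ Ico x y := fun v hv => ⟨h.mem.1.trans hv.1, hv.2.trans_lt ha.2⟩
      have htr := h.comp.translation hft (n := m) hsub (h.notMem_earlyCrit_right ha.2)
        ⟨hca, le_rfl⟩ (fun i hi him => hret i hi him.le)
      exact hcJ' m (hJ'.iterate_mem hft (hsub.trans hX) (htr m le_rfl) ⟨hca, le_rfl⟩
        ⟨le_rfl, hca⟩ hbN)
    refine ⟨ha.1.trans_lt hac, fun v hv => ⟨m, ?_⟩⟩
    have hmax : max a v < c := max_lt hac hv.2
    have hsub : Icc x (max a v) ⊆ Ico x y := fun w hw =>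
      ⟨hw.1, (hw.2.trans_lt hmax).trans h.mem.2⟩
    have hmem : a ∈ Icc x (max a v) := ⟨ha.1, le_max_left _ _⟩
    have htr := h.comp.translation hft (n := m) hsub (h.notMem_earlyCrit_left hmax)
      hmem (fun i hi him => hret i hi him.le)
    exact hJ'.iterate_mem hft (hsub.trans hX) (htr m le_rfl) hmem ⟨hv.1, le_max_right _ _⟩ hbN
  obtain ⟨hxc, hleft⟩ := hleft
  have hnontriv : ¬ T.DynTrivial (Ico x y) := fun htriv =>
    htriv.2.1 c (by rw [interior_Ico]; exact ⟨hxc, h.mem.2⟩) ⟨0, hc⟩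
  have hexc := h.comp.exists_return hft h.mem
  obtain ⟨n, ⟨hn, hnJ⟩, hmin⟩ : ∃ n, (0 < n ∧ T.f^[n] c ∈ Ico x y) ∧
      ∀ i, 0 < i → i < n → T.f^[i] c ∉ Ico x y :=
    ⟨Nat.find hexc, Nat.find_spec hexc, fun i hi hin hmem => Nat.find_min hexc hin ⟨hi, hmem⟩⟩
  have hsub : ∀ {v}, v < y → Icc c v ⊆ Ico x y := fun hv w hw =>
    ⟨h.mem.1.trans hw.1, hw.2.trans_lt hv⟩
  have htrv : ∀ {v}, v ∈ Ico c y → ∀ i ≤ n, ∀ w ∈ Icc c v,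
      T.f^[i] w = T.f^[i] c + (w - c) := fun hv =>
    h.comp.translation hft (hsub hv.2) (h.notMem_earlyCrit_right hv.2) ⟨le_rfl, hv.1⟩ hmin
  have htr : ∀ v ∈ Ico c y, ∀ i ≤ n, T.f^[i] v = T.f^[i] c + (v - c) := fun v hv i hi =>
    htrv hv i hi v ⟨hv.1, le_rfl⟩
  have hmove : ∀ v ∈ Ico c y, ∀ i ≤ n, T.f^[i] v ∈ Ico x y → T.f^[i] c ∈ Ico x y :=
    fun v hv i hi => h.comp.iterate_mem hft ((hsub hv.2).trans hX) (htrv hv i hi)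
      ⟨hv.1, le_rfl⟩ ⟨le_rfl, hv.1⟩
  have hmove' : ∀ v ∈ Ico c y, T.f^[n] v ∈ Ico x y := fun v hv =>
    h.comp.iterate_mem hft ((hsub hv.2).trans hX) (htrv hv n le_rfl)
      ⟨le_rfl, hv.1⟩ ⟨hv.1, le_rfl⟩ hnJ
  have hunit : ∀ v ∈ Ico c y, ∀ i, T.f^[i] v ∈ unitIco := fun v hv i =>
    T.X_subset_unitIco (hft.mapsTo_X.iterate i (hX ⟨h.mem.1.trans hv.1, hv.2⟩))
  have hcc : c ∈ Ico c y := ⟨le_rfl, h.mem.2⟩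
  have hfix : T.f^[n] c = c := by
    have hge : c ≤ T.f^[n] c := by
      by_contra! hlt
      obtain ⟨m, hm⟩ := hleft _ ⟨hnJ.1, hlt⟩
      rw [← Function.iterate_add_apply] at hm
      exact hcJ' _ hm
    by_contra hne
    have hlt : c < T.f^[n] c := lt_of_le_of_ne hge (Ne.symm hne)
    have hv : y - (T.f^[n] c - c) ∈ Ico c y := ⟨by linarith [hnJ.2], by linarith⟩
    have := (hmove' _ hv).2
    rw [htr _ hv n le_rfl] at this
    linarith
  -- The right end of the `i`-th image of `[c, y)`.
  set e : ℕ → ℝ := fun i => T.f^[i] c + (y - c) with he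
  have hbelow : ∀ i ≤ n, ∀ p ∈ Ico (T.f^[i] c) (e i), c + (p - T.f^[i] c) ∈ Ico c y ∧
      T.f^[i] (c + (p - T.f^[i] c)) = p := by
    intro i hi p hp
    have hmem : c + (p - T.f^[i] c) ∈ Ico c y :=
      ⟨by linarith [hp.1], by have := hp.2; simp only [he] at this; linarith⟩
    exact ⟨hmem, by rw [htr _ hmem i hi]; ring⟩
  have hlt_e : ∀ i, T.f^[i] c < e i := fun i => by
    simp only [he]; linarith [h.mem.2]
  have he_le : ∀ i ≤ n, e i ≤ 1 := by
    intro i hi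
    by_contra! hgt
    have hp : max (T.f^[i] c) 1 ∈ Ico (T.f^[i] c) (e i) :=
      ⟨le_max_left _ _, max_lt (hlt_e i) hgt⟩
    obtain ⟨hmem, heq⟩ := hbelow i hi _ hp
    have := (hunit _ hmem i).2
    rw [heq] at this
    exact absurd (le_max_right (T.f^[i] c) 1) (not_le.mpr this)
  have hfm : ∀ i ≤ n, T.fm^[i] y = e i := by
    intro i
    induction i with
    | zero => intro _; simp [he]
    | succ i ih =>
      intro hi
      rw [Function.iterate_succ_apply', ih (by omega),
        T.fm_eq_of_translation (s := T.f^[i + 1] c - T.f^[i] c) (hunit c hcc i).1 (hlt_e i)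
          (he_le i (by omega))]
      · simp only [he]; ring
      · intro p hp
        obtain ⟨hmem, heq⟩ := hbelow i (by omega) p hp
        have := htr _ hmem (i + 1) hi
        rw [Function.iterate_succ_apply', heq] at this
        rw [this]
        ring
  have hcrit : ∀ k < n, e k ∉ T.critSet := by
    intro k hk hmem
    have hlt : k < T.sReturnTime x y (y, false) := by
      have hset : {k : ℕ | 0 < k ∧ smem x y (T.sf^[k] (y, false))}.Nonempty := by
        refine ⟨n, hn, ?_⟩
        rw [sf_iterate_false, hfm n le_rfl]
        simp only [smem, he, hfix]
        simpa using hxc.trans h.mem.2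
      obtain ⟨hpos, hs⟩ := Nat.sInf_mem hset
      refine lt_of_not_ge fun hle => ?_
      rw [sReturnTime] at hle
      set j := sInf {k : ℕ | 0 < k ∧ smem x y (T.sf^[k] (y, false))}
      rw [sf_iterate_false, hfm j (by omega)] at hs
      simp only [smem, Bool.false_eq_true, if_false] at hs
      have hp : max (T.f^[j] c) x ∈ Ico (T.f^[j] c) (e j) :=
        ⟨le_max_left _ _, max_lt (hlt_e j) hs.1⟩
      obtain ⟨hv, heq⟩ := hbelow j (by omega) _ hp
      refine hmin j hpos (by omega) (hmove _ hv j (by omega) ?_)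
      rw [heq]
      exact ⟨le_max_right _ _, hp.2.trans_le hs.2⟩
    refine (h2 x y h.comp hnontriv).2 k hlt ?_
    rw [sf_iterate_false, hfm k hk.le]
    exact hmem
  have hone : ∃ k < n, e k = 1 := by
    by_contra! hne
    have hlt1 : ∀ k < n, e k < 1 := fun k hk => lt_of_le_of_ne (he_le k hk.le) (hne k hk)
    have hf : ∀ i ≤ n, T.f^[i] y = e i := by
      intro i
      induction i with
      | zero => intro _; simp [he]
      | succ i ih =>
        intro hi
        rw [Function.iterate_succ_apply', ih (by omega),
          T.f_eq_fm ((hunit c hcc i).1.trans_lt (hlt_e i)) (hlt1 i (by omega))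
            (hcrit i (by omega)), ← hfm i (by omega), ← Function.iterate_succ_apply' T.fm,
          hfm _ hi]
    have hyX : y ∈ T.X := by
      refine T.mem_X_of_periodic hn ⟨?_, ?_⟩ ?_
      · exact ((hunit c hcc 0).1 : (0 : ℝ) ≤ c).trans h.mem.2.le
      · have := hlt1 0 hn
        simpa [he] using this
      · rw [hf n le_rfl]
        simp only [he, hfix]
        ring
    have hIcc : Icc x y ⊆ T.X := by
      intro v hv
      rcases hv.2.lt_or_eq with hlt | rfl
      · exact hX ⟨hv.1, hlt⟩
      · exact hyX
    have := h.comp.Icc_subset hIcc ⟨h.mem.1, h.mem.2.le⟩ h.mem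
      (right_mem_Icc.mpr (h.mem.1.trans h.mem.2.le))
    exact lt_irrefl _ this.2
  obtain ⟨k, hk, hek⟩ := hone
  refine ⟨k, fun p hp hp1 => ⟨n - k, ?_⟩⟩
  obtain ⟨hv, heq⟩ := hbelow k hk.le p ⟨hp, by rwa [hek]⟩
  rw [← heq, ← Function.iterate_add_apply, Nat.sub_add_cancel hk.le]
  exact hmove' _ hv

/-- No orbit starting in one critical component enters another. -/
lemma IsCritComponent.iterate_notMem (hft : T.FiniteType) (h2 : T.A2) {x y c x' y' c' : ℝ}
    (h : T.IsCritComponent x y c) (h' : T.IsCritComponent x' y' c') (hc : c ∈ T.critSet)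
    (hc' : c' ∈ T.critSet) (hne : Ico x y ≠ Ico x' y') {b : ℝ} (hb : b ∈ Ico x y) (N : ℕ) :
    T.f^[N] b ∉ Ico x' y' := by
  intro hN
  have hcne : c ≠ c' := by
    rintro rfl
    exact hne (h.comp.eq_of_mem h'.comp h.mem h'.mem)
  have havoid := h'.iterate_crit_notMem hft hc hcne (h.comp.subset_X h.mem)
  have havoid' := h.iterate_crit_notMem hft hc' hcne.symm (h'.comp.subset_X h'.mem)
  obtain ⟨n, hn, hnJ⟩ := h.comp.exists_return_ge hft hb N
  obtain ⟨m, rfl⟩ := Nat.exists_eq_add_of_le' hn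
  rw [Function.iterate_add_apply] at hnJ
  obtain ⟨k, hk⟩ := h.exists_tail_visits hft h2 hc h'.comp havoid hb hN
  obtain ⟨k', hk'⟩ := h'.exists_tail_visits hft h2 hc' h.comp havoid' hN hnJ
  have hlt := (T.X_subset_unitIco (hft.mapsTo_X.iterate k (h.comp.subset_X h.mem))).2
  have hlt' := (T.X_subset_unitIco (hft.mapsTo_X.iterate k' (h'.comp.subset_X h'.mem))).2
  rcases le_total (T.f^[k] c) (T.f^[k'] c') with hle | hle
  · obtain ⟨i, hi⟩ := hk _ hle hlt'
    rw [← Function.iterate_add_apply] at hi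
    exact havoid' _ hi
  · obtain ⟨i, hi⟩ := hk' _ hle hlt
    rw [← Function.iterate_add_apply] at hi
    exact havoid _ hi

end CriticalComponents

end ITM

/-- For a finite type map satisfying A1, A2 and Matching, the forward orbit of any
`z ∈ X` enters at most one interval component of `X` containing a discontinuity. -/
theorem orbit_enters_at_most_one_critical_component {r : ℕ} (T : ITM r)
    (hft : T.FiniteType) (h1 : T.A1) (h2 : T.A2) (hm : T.Matching) :
    ∀ z ∈ T.X, Set.Subsingleton
      {J : Set ℝ | T.IsIntervalComponent J ∧ (J ∩ T.critSet).Nonempty ∧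
        ∃ k : ℕ, (T.f)^[k] z ∈ J} := by
  rintro z - J ⟨hJ, ⟨c, hcJ, hc⟩, k, hk⟩ J' ⟨hJ', ⟨c', hcJ', hc'⟩, k', hk'⟩
  obtain ⟨x, y, -, rfl⟩ := hJ.2
  obtain ⟨x', y', -, rfl⟩ := hJ'.2
  have h := hJ.isCritComponent hft h1 h2 hm hcJ hc
  have h' := hJ'.isCritComponent hft h1 h2 hm hcJ' hc'
  by_contra hne
  rcases le_total k k' with hle | hle
  · obtain ⟨m, rfl⟩ := Nat.exists_eq_add_of_le' hle
    rw [Function.iterate_add_apply] at hk'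
    exact h.iterate_notMem hft h2 h' hc hc' hne hk m hk'
  · obtain ⟨m, rfl⟩ := Nat.exists_eq_add_of_le' hle
    rw [Function.iterate_add_apply] at hk
    exact h'.iterate_notMem hft h2 h hc' hc (Ne.symm hne) hk' m hk
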